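/- Let G = PSL(2,ℤ) with r, u, S = {r, u, u⁻¹} as above. For every g ∈ G there exists a ∈ {u, u⁻¹} (writing ā = a⁻¹) such that 𝐒₂*(g) is one of the following eight sets of words: ∅, {r}, {ar}, {a}, {ra}, {aa}, {ra, aa}, {ra, ār}. -/

import Mathlib

namespace PSL2Z

abbrev SL2Z : Type := Matrix.SpecialLinearGroup (Fin 2) ℤ

/-- `PSL(2,ℤ)`: the quotient of `SL(2,ℤ)` by its center `{±I}`. -/
abbrev G : Type := SL2Z ⧸ Subgroup.center SL2Z

/-- The image in `PSL(2,ℤ)` of the matrix `[[0,1],[-1,0]]`. -/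
def r : G := QuotientGroup.mk (⟨!![0, 1; -1, 0], by norm_num [Matrix.det_fin_two_of]⟩ : SL2Z)

/-- The image in `PSL(2,ℤ)` of the matrix `[[1,1],[0,1]]`. -/
def u : G := QuotientGroup.mk (⟨!![1, 1; 0, 1], by norm_num [Matrix.det_fin_two_of]⟩ : SL2Z)

/-- The symmetric generating set `S = {r, u, u⁻¹}`. -/
def S : Set G := {r, u, u⁻¹}

/-- A word in `S`: a finite list of elements of `S`. -/
def IsWord (w : List G) : Prop := ∀ x ∈ w, x ∈ S

/-- The word norm `|g|`: the least length of a word in `S` representing `g`. -/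
noncomputable def wordNorm (g : G) : ℕ :=
  sInf {n | ∃ w : List G, IsWord w ∧ w.prod = g ∧ w.length = n}

/-- A geodesic for `g`: a word in `S` representing `g` of length `|g|`. -/
def IsGeodesic (g : G) (w : List G) : Prop :=
  IsWord w ∧ w.prod = g ∧ w.length = wordNorm g

/-- `𝐒ₙ(g)`: the set of suffixes of length `n` of geodesics for `g`. -/
def Suf (n : ℕ) (g : G) : Set (List G) :=
  {v | v.length = n ∧ ∃ w : List G, IsGeodesic g w ∧ v <:+ w}

open Classical in
/-- `𝐒₂*(g)`: `𝐒₂(g)` if nonempty, otherwise `𝐒₁(g)` (which is `∅` exactly when `g = 1`). -/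
noncomputable def Suf2Star (g : G) : Set (List G) :=
  if (Suf 2 g).Nonempty then Suf 2 g else Suf 1 g

/-- `S⁺(g) = {s ∈ S : |g·s| = |g| + 1}`. -/
def Splus (g : G) : Set G := {s ∈ S | wordNorm (g * s) = wordNorm g + 1}

/-- The generator `u` or `u⁻¹`, according to a direction. -/
def a (d : Bool) : G := cond d u u⁻¹

/-- The sign of a direction. -/
def sgn (d : Bool) : ℤ := cond d 1 (-1)

/-- The matrix `[[0,1],[-1,0]]` representing `r`. -/
def matR : SL2Z := ⟨!![0, 1; -1, 0], by norm_num [Matrix.det_fin_two_of]⟩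

/-- The upper unitriangular matrix with corner `s`. -/
def matU (s : ℤ) : SL2Z := ⟨!![1, s; 0, 1], by norm_num [Matrix.det_fin_two_of]⟩

theorem coe_matR : (matR : Matrix (Fin 2) (Fin 2) ℤ) = !![0, 1; -1, 0] := rfl

theorem coe_matU (s : ℤ) : (matU s : Matrix (Fin 2) (Fin 2) ℤ) = !![1, s; 0, 1] := rfl

theorem mul_matR_apply_zero (A : SL2Z) (i : Fin 2) : (A * matR) i 0 = -A i 1 := by
  simp [coe_matR, Matrix.mul_apply, Fin.sum_univ_two]

theorem mul_matR_apply_one (A : SL2Z) (i : Fin 2) : (A * matR) i 1 = A i 0 := by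
  simp [coe_matR, Matrix.mul_apply, Fin.sum_univ_two]

theorem mul_matU_apply_zero (A : SL2Z) (s : ℤ) (i : Fin 2) : (A * matU s) i 0 = A i 0 := by
  simp [coe_matU, Matrix.mul_apply, Fin.sum_univ_two]

theorem mul_matU_apply_one (A : SL2Z) (s : ℤ) (i : Fin 2) :
    (A * matU s) i 1 = A i 0 * s + A i 1 := by
  simp [coe_matU, Matrix.mul_apply, Fin.sum_univ_two]

theorem r_eq_mk : r = QuotientGroup.mk matR := rfl

theorem u_eq_mk : u = QuotientGroup.mk (matU 1) := rfl

theorem mk_eq_mk_iff {A B : SL2Z} :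
    (QuotientGroup.mk A : G) = QuotientGroup.mk B ↔ B = A ∨ B = -A := by
  rw [QuotientGroup.eq, Matrix.SpecialLinearGroup.mem_center_iff]
  constructor
  · rintro ⟨c, hc, h⟩
    rw [Fintype.card_fin, sq_eq_one_iff] at hc
    rcases hc with rfl | rfl
    · left
      have : A⁻¹ * B = 1 := by
        apply Subtype.ext
        rw [← h]; simp
      rw [inv_mul_eq_one] at this
      exact this.symm
    · right
      have : A⁻¹ * B = -1 := by
        apply Subtype.ext
        rw [← h]; simp [← Matrix.diagonal_one, Matrix.diagonal_neg]
      rw [inv_mul_eq_iff_eq_mul] at this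
      simpa using this
  · rintro (rfl | rfl)
    · exact ⟨1, by simp, by simp⟩
    · exact ⟨-1, by simp, by simp [← Matrix.diagonal_one, Matrix.diagonal_neg]⟩

theorem r_mul_r : r * r = 1 := by
  rw [r_eq_mk, ← QuotientGroup.mk_mul, ← QuotientGroup.mk_one, mk_eq_mk_iff]
  right
  ext i j
  fin_cases i <;> fin_cases j <;> simp [coe_matR]

theorem r_inv : r⁻¹ = r := inv_eq_of_mul_eq_one_left r_mul_r

theorem a_inv (d : Bool) : (a d)⁻¹ = a (!d) := by cases d <;> simp [a]

theorem a_mul_r_mul_a (d : Bool) : a d * r * a d = r * a (!d) * r := by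
  have h : u * r * u = r * u⁻¹ * r := by
    rw [r_eq_mk, u_eq_mk, ← QuotientGroup.mk_inv]
    simp only [← QuotientGroup.mk_mul]
    congr 1
    ext i j
    fin_cases i <;> fin_cases j <;>
      simp [coe_matR, coe_matU, Matrix.SpecialLinearGroup.coe_inv, Matrix.adjugate_fin_two]
  cases d
  · have h' := congrArg (·⁻¹) h
    simp only [mul_inv_rev, r_inv, inv_inv, ← mul_assoc] at h'
    exact h'
  · exact h

theorem a_eq_mk (d : Bool) : a d = QuotientGroup.mk (matU (sgn d)) := by
  cases d
  · rw [a, cond_false, u_eq_mk, ← QuotientGroup.mk_inv]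
    congr 1
    ext i j
    fin_cases i <;> fin_cases j <;>
      simp [coe_matU, sgn, Matrix.SpecialLinearGroup.coe_inv, Matrix.adjugate_fin_two]
  · rfl

theorem mem_S_iff (d : Bool) (s : G) : s ∈ S ↔ s = r ∨ s = a d ∨ s = a (!d) := by
  simp only [S, Set.mem_insert_iff, Set.mem_singleton_iff]
  cases d
  · rw [or_comm (a := s = u)]
    rfl
  · rfl

/-- The element of an edge `{x, x * r}` closest to `1`, where the edge is reached by leaving `1` in
direction `d` or `!d` and following a list of steps, the last one first. The step `true` keeps the
direction and the step `false` crosses the edge and reverses it; the final direction is `d`. -/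
def low (d : Bool) : List Bool → G
  | [] => 1
  | true :: l => low d l * a d
  | false :: l => low (!d) l * r * a d

/-- The distance from `1` to `low d l`. -/
def len : List Bool → ℕ
  | [] => 0
  | true :: l => len l + 1
  | false :: l => len l + 2

theorem low_bound (d : Bool) (l : List Bool) :
    ∃ A : SL2Z, QuotientGroup.mk A = low d l ∧ (∀ i, 0 ≤ sgn d * A i 0 * A i 1) ∧
      (l = [] ∧ A = 1 ∨ ∀ i, A i 0 ^ 2 ≤ sgn d * A i 0 * A i 1) := by
  induction l generalizing d with
  | nil =>
    refine ⟨1, rfl, fun i => ?_, by simp⟩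
    fin_cases i <;> simp
  | cons b l ih =>
    have key : ∀ A : SL2Z, QuotientGroup.mk A = low d (b :: l) →
        (∀ i, A i 0 ^ 2 ≤ sgn d * A i 0 * A i 1) →
        ∃ A : SL2Z, QuotientGroup.mk A = low d (b :: l) ∧ (∀ i, 0 ≤ sgn d * A i 0 * A i 1) ∧
          (b :: l = [] ∧ A = 1 ∨ ∀ i, A i 0 ^ 2 ≤ sgn d * A i 0 * A i 1) := fun A hA h =>
      ⟨A, hA, fun i => (sq_nonneg _).trans (h i), Or.inr h⟩
    have hs : sgn d * sgn d = 1 := by cases d <;> rfl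
    cases b
    · obtain ⟨A, hA, h, -⟩ := ih (!d)
      have hn : sgn (!d) = -sgn d := by cases d <;> rfl
      refine key (A * matR * matU (sgn d))
        (by rw [low, a_eq_mk, r_eq_mk, ← hA, QuotientGroup.mk_mul, QuotientGroup.mk_mul]) fun i => ?_
      have := h i
      rw [hn] at this
      simp only [mul_matR_apply_zero, mul_matR_apply_one, mul_matU_apply_zero,
        mul_matU_apply_one]
      linear_combination this - (A i 1) ^ 2 * hs
    · obtain ⟨A, hA, h, -⟩ := ih d
      refine key (A * matU (sgn d)) (by rw [low, a_eq_mk, ← hA, QuotientGroup.mk_mul]) fun i => ?_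
      have := h i
      simp only [mul_matU_apply_zero, mul_matU_apply_one]
      linear_combination this - (A i 0) ^ 2 * hs

theorem sq_le_sq_of_sq_le_sgn_mul {d : Bool} {x y : ℤ} (h : x ^ 2 ≤ sgn d * x * y) :
    x ^ 2 ≤ y ^ 2 := by
  cases d <;> simp only [sgn, cond_true, cond_false] at h
  · nlinarith [sq_nonneg (x + y)]
  · nlinarith [sq_nonneg (x - y)]

theorem low_ne_low_mul_r (d d' : Bool) (l l' : List Bool) : low d l ≠ low d' l' * r := by
  obtain ⟨A, hA, -, h⟩ := low_bound d l
  obtain ⟨B, hB, -, h'⟩ := low_bound d' l'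
  intro e
  rw [← hA, ← hB, r_eq_mk, ← QuotientGroup.mk_mul, mk_eq_mk_iff] at e
  have hcol : ∀ i, B i 1 ^ 2 = A i 0 ^ 2 ∧ B i 0 ^ 2 = A i 1 ^ 2 := by
    intro i
    have h0 := mul_matR_apply_zero B i
    have h1 := mul_matR_apply_one B i
    rcases e with e | e
    · rw [e] at h0 h1
      rw [h0, h1, neg_sq]
      exact ⟨rfl, rfl⟩
    · rw [e, Matrix.SpecialLinearGroup.coe_neg, Matrix.neg_apply] at h0 h1
      rw [neg_inj.1 h0, ← h1, neg_sq]
      exact ⟨rfl, rfl⟩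
  rcases h with ⟨-, rfl⟩ | h
  · rcases h' with ⟨-, rfl⟩ | h'
    · simpa using hcol 0
    · have h1 := sq_le_sq_of_sq_le_sgn_mul (h' 1)
      rw [(hcol 1).1, (hcol 1).2] at h1
      simp at h1
  · rcases h' with ⟨-, rfl⟩ | h'
    · have h1 := sq_le_sq_of_sq_le_sgn_mul (h 1)
      rw [← (hcol 1).1, ← (hcol 1).2] at h1
      simp at h1
    · have hsq : ∀ i, A i 1 = A i 0 ∨ A i 1 = -A i 0 := fun i => by
        rw [← sq_eq_sq_iff_eq_or_eq_neg]
        have h1 := sq_le_sq_of_sq_le_sgn_mul (h' i)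
        rw [(hcol i).1, (hcol i).2] at h1
        exact h1.antisymm (sq_le_sq_of_sq_le_sgn_mul (h i))
      have hdet := A.det_coe
      rw [Matrix.det_fin_two] at hdet
      rcases hsq 0 with h0 | h0 <;> rcases hsq 1 with h1 | h1 <;> rw [h0, h1] at hdet <;>
        ring_nf at hdet <;> omega

theorem low_ne_one (d : Bool) {l : List Bool} (hl : l ≠ []) : low d l ≠ 1 := by
  obtain ⟨A, hA, -, h⟩ := low_bound d l
  replace h := h.resolve_left (fun h => hl h.1)
  rw [← hA, ← QuotientGroup.mk_one, ne_comm, Ne, mk_eq_mk_iff]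
  rintro (rfl | rfl) <;> simpa using h 0

theorem dir_eq_of_low_eq_low {d d' : Bool} {l l' : List Bool} (hl : l ≠ []) (hl' : l' ≠ [])
    (e : low d l = low d' l') : d = d' := by
  obtain ⟨A, hA, -, h⟩ := low_bound d l
  obtain ⟨B, hB, -, h'⟩ := low_bound d' l'
  replace h := h.resolve_left (fun h => hl h.1)
  replace h' := h'.resolve_left (fun h => hl' h.1)
  rw [← hA, ← hB, mk_eq_mk_iff] at e
  by_contra hd
  have hs : sgn d' = -sgn d := by revert hd; cases d <;> cases d' <;> simp [sgn]
  have h0 : ∀ i, A i 0 = 0 := fun i => by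
    have h1 := h i
    have h2 := h' i
    have h3 : A i 0 ^ 2 ≤ -(sgn d * A i 0 * A i 1) := by
      rcases e with rfl | rfl
      · rw [hs] at h2
        linarith
      · rw [hs] at h2
        simp only [Matrix.SpecialLinearGroup.coe_neg, Matrix.neg_apply] at h2
        linarith
    nlinarith
  have hdet := A.det_coe
  rw [Matrix.det_fin_two, h0, h0] at hdet
  simp at hdet

theorem low_injective {d d' : Bool} {l l' : List Bool} (h : low d l = low d' l') : l = l' := by
  induction l generalizing d d' l' with
  | nil =>
    by_contra hl
    exact low_ne_one d' (Ne.symm hl) h.symm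
  | cons b l ih =>
    cases l' with
    | nil => exact absurd h (low_ne_one d (List.cons_ne_nil b l))
    | cons b' l' =>
      obtain rfl := dir_eq_of_low_eq_low (List.cons_ne_nil b l) (List.cons_ne_nil b' l') h
      cases b <;> cases b' <;> replace h := mul_right_cancel h
      · rw [ih (mul_right_cancel h)]
      · exact absurd h.symm (low_ne_low_mul_r _ _ _ _)
      · exact absurd h (low_ne_low_mul_r _ _ _ _)
      · rw [ih h]

theorem low_mul_a_not_true (d : Bool) (l : List Bool) : low d (true :: l) * a (!d) = low d l := by
  rw [low, ← a_inv, mul_inv_cancel_right]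

theorem low_mul_a_not_false (d : Bool) (l : List Bool) :
    low d (false :: l) * a (!d) = low (!d) l * r := by
  rw [low, ← a_inv, mul_inv_cancel_right]

theorem high_mul_r (d : Bool) (l : List Bool) : low d l * r * r = low d l := by
  rw [mul_assoc, r_mul_r, mul_one]

theorem high_mul_a_not (d : Bool) (l : List Bool) :
    low d l * r * a (!d) = low (!d) (false :: l) := by
  rw [low, Bool.not_not]

theorem high_mul_a_true (d : Bool) (l : List Bool) :
    low d (true :: l) * r * a d = low (!d) (false :: l) * r := by
  simp only [low, Bool.not_not]
  rw [mul_assoc, mul_assoc, ← mul_assoc (a d), a_mul_r_mul_a]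
  simp only [mul_assoc]

theorem high_mul_a_false (d : Bool) (l : List Bool) :
    low d (false :: l) * r * a d = low (!d) (true :: l) * r := by
  simp only [low]
  rw [mul_assoc, mul_assoc, ← mul_assoc (a d), a_mul_r_mul_a]
  simp only [mul_assoc]
  rw [← mul_assoc r r, r_mul_r, one_mul]

theorem a_mem_S {d : Bool} : a d ∈ S := (mem_S_iff d _).2 (by simp)

theorem r_mem_S : r ∈ S := (mem_S_iff true _).2 (by simp)

theorem inv_mem_S {s : G} (h : s ∈ S) : s⁻¹ ∈ S := by
  rcases (mem_S_iff true s).1 h with rfl | rfl | rfl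
  · rw [r_inv]; exact r_mem_S
  · rw [a_inv]; exact a_mem_S
  · rw [a_inv]; exact a_mem_S

theorem exists_low_of_isWord (w : List G) (hw : IsWord w) :
    ∃ d l, (w.prod = low d l ∧ len l ≤ w.length) ∨
      (w.prod = low d l * r ∧ len l + 1 ≤ w.length) := by
  induction w using List.reverseRecOn with
  | nil => exact ⟨true, [], Or.inl ⟨rfl, le_rfl⟩⟩
  | append_singleton w s ih =>
    simp only [List.prod_append, List.prod_singleton, List.length_append, List.length_singleton]
    have hs : s ∈ S := hw s (by simp)
    obtain ⟨d, l, ⟨e, h⟩ | ⟨e, h⟩⟩ := ih fun x hx => hw x (by simp [hx])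
    · rw [e]
      rcases (mem_S_iff d s).1 hs with rfl | rfl | rfl
      · exact ⟨d, l, Or.inr ⟨rfl, by omega⟩⟩
      · exact ⟨d, true :: l, Or.inl ⟨rfl, by rw [len]; omega⟩⟩
      · match l with
        | [] => exact ⟨!d, [true], Or.inl ⟨rfl, by simp only [len] at *; omega⟩⟩
        | true :: l =>
          exact ⟨d, l, Or.inl ⟨low_mul_a_not_true d l, by simp only [len] at *; omega⟩⟩
        | false :: l =>
          exact ⟨!d, l, Or.inr ⟨low_mul_a_not_false d l, by simp only [len] at *; omega⟩⟩
    · rw [e]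
      rcases (mem_S_iff d s).1 hs with rfl | rfl | rfl
      · exact ⟨d, l, Or.inl ⟨high_mul_r d l, by omega⟩⟩
      · match l with
        | [] => exact ⟨d, [false], Or.inl ⟨rfl, by simp only [len] at *; omega⟩⟩
        | true :: l =>
          exact ⟨!d, false :: l, Or.inr ⟨high_mul_a_true d l, by simp only [len] at *; omega⟩⟩
        | false :: l =>
          exact ⟨!d, true :: l, Or.inr ⟨high_mul_a_false d l, by simp only [len] at *; omega⟩⟩
      · exact ⟨!d, false :: l, Or.inl ⟨high_mul_a_not d l, by simp only [len] at *; omega⟩⟩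

theorem IsWord.append {w w' : List G} (hw : IsWord w) (hw' : IsWord w') : IsWord (w ++ w') :=
  fun x hx => (List.mem_append.1 hx).elim (hw x) (hw' x)

theorem isWord_singleton {s : G} (hs : s ∈ S) : IsWord [s] := fun x hx => by
  rwa [List.mem_singleton.1 hx]

theorem exists_word (g : G) : ∃ w, IsWord w ∧ w.prod = g := by
  obtain ⟨A, rfl⟩ := QuotientGroup.mk_surjective g
  have hA : A ∈ Subgroup.closure {ModularGroup.S, ModularGroup.T} :=
    SpecialLinearGroup.SL2Z_generators ▸ Subgroup.mem_top A
  induction hA using Subgroup.closure_induction with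
  | mem A hA =>
    rcases hA with rfl | rfl
    · refine ⟨[r], isWord_singleton r_mem_S, ?_⟩
      rw [List.prod_singleton, r_eq_mk, mk_eq_mk_iff]
      right
      ext i j
      fin_cases i <;> fin_cases j <;> simp [coe_matR, ModularGroup.S]
    · exact ⟨[u], isWord_singleton (Set.mem_insert_of_mem _ (Set.mem_insert _ _)),
        List.prod_singleton⟩
  | one => exact ⟨[], by simp [IsWord], rfl⟩
  | mul A B _ _ hA hB =>
    obtain ⟨v, hv, ev⟩ := hA
    obtain ⟨w, hw, ew⟩ := hB
    exact ⟨v ++ w, hv.append hw, by rw [List.prod_append, ev, ew, QuotientGroup.mk_mul]⟩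
  | inv A _ hA =>
    obtain ⟨v, hv, ev⟩ := hA
    refine ⟨(v.map (·⁻¹)).reverse, fun x hx => ?_, ?_⟩
    · obtain ⟨y, hy, rfl⟩ := List.mem_map.1 (List.mem_reverse.1 hx)
      exact inv_mem_S (hv y hy)
    · rw [← List.prod_inv_reverse, ev, QuotientGroup.mk_inv]

theorem exists_geodesic (g : G) : ∃ w, IsGeodesic g w := by
  obtain ⟨w, hw, e⟩ := exists_word g
  obtain ⟨v, hv, e, h⟩ := Nat.sInf_mem
    (s := {n | ∃ w : List G, IsWord w ∧ w.prod = g ∧ w.length = n}) ⟨_, w, hw, e, rfl⟩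
  exact ⟨v, hv, e, h⟩

theorem wordNorm_le {g : G} {w : List G} (hw : IsWord w) (e : w.prod = g) :
    wordNorm g ≤ w.length := Nat.sInf_le ⟨w, hw, e, rfl⟩

theorem wordNorm_mul_le (g : G) {s : G} (hs : s ∈ S) : wordNorm (g * s) ≤ wordNorm g + 1 := by
  obtain ⟨w, hw, e, h⟩ := exists_geodesic g
  have := wordNorm_le (g := g * s) (hw.append (isWord_singleton hs)) (by simp [e])
  simpa [h] using this

theorem exists_low (g : G) :
    ∃ d l, (g = low d l ∧ len l ≤ wordNorm g) ∨ (g = low d l * r ∧ len l + 1 ≤ wordNorm g) := by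
  obtain ⟨w, hw, e, h⟩ := exists_geodesic g
  rw [← h, ← e]
  exact exists_low_of_isWord w hw

theorem wordNorm_low (d : Bool) (l : List Bool) : wordNorm (low d l) = len l := by
  apply le_antisymm
  · induction l generalizing d with
    | nil => exact wordNorm_le (w := []) (by simp [IsWord]) rfl
    | cons b l ih =>
      cases b
      · have h1 := wordNorm_mul_le (low (!d) l * r) (a_mem_S (d := d))
        have h2 := wordNorm_mul_le (low (!d) l) r_mem_S
        have h3 := ih (!d)
        simp only [low, len]
        omega
      · have h1 := wordNorm_mul_le (low d l) (a_mem_S (d := d))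
        have h3 := ih d
        simp only [low, len]
        omega
  · obtain ⟨d', l', ⟨e, h⟩ | ⟨e, h⟩⟩ := exists_low (low d l)
    · rwa [← low_injective e] at h
    · exact absurd e (low_ne_low_mul_r _ _ _ _)

theorem wordNorm_high (d : Bool) (l : List Bool) : wordNorm (low d l * r) = len l + 1 := by
  apply le_antisymm
  · rw [← wordNorm_low d l]
    exact wordNorm_mul_le _ r_mem_S
  · obtain ⟨d', l', ⟨e, h⟩ | ⟨e, h⟩⟩ := exists_low (low d l * r)
    · exact absurd e.symm (low_ne_low_mul_r _ _ _ _)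
    · rwa [← low_injective (mul_right_cancel e)] at h

/-- The possible last letters of geodesics for `g`. -/
def lastLetters (g : G) : Set G := {s ∈ S | wordNorm (g * s⁻¹) + 1 = wordNorm g}

theorem isGeodesic_append_singleton {g s : G} {w : List G} :
    IsGeodesic g (w ++ [s]) ↔ s ∈ lastLetters g ∧ IsGeodesic (g * s⁻¹) w := by
  constructor
  · rintro ⟨hw, e, h⟩
    have hs : s ∈ S := hw s (by simp)
    have hw' : IsWord w := fun x hx => hw x (by simp [hx])
    have e' : w.prod = g * s⁻¹ := by simp [← e]
    have h1 := wordNorm_le hw' e'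
    have h2 := wordNorm_mul_le (g * s⁻¹) hs
    rw [inv_mul_cancel_right] at h2
    rw [List.length_append, List.length_singleton] at h
    exact ⟨⟨hs, by omega⟩, hw', e', by omega⟩
  · rintro ⟨⟨hs, h⟩, hw, e, h'⟩
    exact ⟨hw.append (isWord_singleton hs), by simp [e], by simp [h', h]⟩

theorem suf_one (g : G) : Suf 1 g = (fun s => [s]) '' lastLetters g := by
  ext v
  constructor
  · rintro ⟨hv, w, hw, x, rfl⟩
    obtain ⟨s, rfl⟩ := List.length_eq_one_iff.1 hv
    exact ⟨s, (isGeodesic_append_singleton.1 hw).1, rfl⟩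
  · rintro ⟨s, hs, rfl⟩
    obtain ⟨w, hw⟩ := exists_geodesic (g * s⁻¹)
    exact ⟨rfl, w ++ [s], isGeodesic_append_singleton.2 ⟨hs, hw⟩, w, rfl⟩

theorem suf_two (g : G) :
    Suf 2 g = ⋃ t ∈ lastLetters g, (fun s => [s, t]) '' lastLetters (g * t⁻¹) := by
  ext v
  simp only [Set.mem_iUnion]
  constructor
  · rintro ⟨hv, w, hw, x, rfl⟩
    obtain ⟨s, t, rfl⟩ := List.length_eq_two.1 hv
    rw [List.append_cons, isGeodesic_append_singleton, isGeodesic_append_singleton] at hw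
    exact ⟨t, hw.1, s, hw.2.1, rfl⟩
  · rintro ⟨t, ht, s, hs, rfl⟩
    obtain ⟨w, hw⟩ := exists_geodesic (g * t⁻¹ * s⁻¹)
    refine ⟨rfl, w ++ [s, t], ?_, w, rfl⟩
    rw [List.append_cons, isGeodesic_append_singleton, isGeodesic_append_singleton]
    exact ⟨ht, hs, hw⟩

theorem mem_lastLetters_iff (d : Bool) {g s : G} :
    s ∈ lastLetters g ↔ s = r ∧ wordNorm (g * r) + 1 = wordNorm g ∨
      s = a d ∧ wordNorm (g * a (!d)) + 1 = wordNorm g ∨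
      s = a (!d) ∧ wordNorm (g * a d) + 1 = wordNorm g := by
  rw [lastLetters, Set.mem_ofPred_eq, mem_S_iff d]
  constructor
  · rintro ⟨rfl | rfl | rfl, h⟩
    · exact Or.inl ⟨rfl, by rwa [r_inv] at h⟩
    · exact Or.inr (Or.inl ⟨rfl, by rwa [a_inv] at h⟩)
    · exact Or.inr (Or.inr ⟨rfl, by rwa [a_inv, Bool.not_not] at h⟩)
  · rintro (⟨rfl, h⟩ | ⟨rfl, h⟩ | ⟨rfl, h⟩)
    · exact ⟨Or.inl rfl, by rwa [r_inv]⟩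
    · exact ⟨Or.inr (Or.inl rfl), by rwa [a_inv]⟩
    · exact ⟨Or.inr (Or.inr rfl), by rwa [a_inv, Bool.not_not]⟩

theorem lastLetters_low_nil (d : Bool) : lastLetters (low d []) = ∅ := by
  ext s
  rw [mem_lastLetters_iff d, wordNorm_low]
  simp [len]

theorem lastLetters_low_cons (d b : Bool) (l : List Bool) :
    lastLetters (low d (b :: l)) = {a d} := by
  ext s
  have h1 : low d (b :: l) * a d = low d (true :: b :: l) := rfl
  rw [mem_lastLetters_iff d, h1]
  cases b
  · rw [low_mul_a_not_false]
    simp [wordNorm_low, wordNorm_high, len]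
  · have h2 : len l + 1 + 1 ≠ len l := by omega
    rw [low_mul_a_not_true]
    simp [h2, wordNorm_low, wordNorm_high, len]

theorem lastLetters_high_nil (d : Bool) : lastLetters (low d [] * r) = {r} := by
  ext s
  have h1 : low d [] * r * a d = low d [false] := rfl
  rw [mem_lastLetters_iff d, high_mul_a_not, high_mul_r, h1]
  simp [wordNorm_low, wordNorm_high, len]

theorem lastLetters_high_true (d : Bool) (l : List Bool) :
    lastLetters (low d (true :: l) * r) = {r} := by
  ext s
  rw [mem_lastLetters_iff d, high_mul_a_not, high_mul_r, high_mul_a_true]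
  simp [wordNorm_low, wordNorm_high, len]

theorem lastLetters_high_false (d : Bool) (l : List Bool) :
    lastLetters (low d (false :: l) * r) = {r, a (!d)} := by
  ext s
  rw [mem_lastLetters_iff d, high_mul_a_not, high_mul_r, high_mul_a_false]
  simp [wordNorm_low, wordNorm_high, len]

theorem suf2Star_eq_suf_two {g : G} {X : Set (List G)} (h : Suf 2 g = X) (hX : X.Nonempty) :
    Suf2Star g = X := by
  rw [Suf2Star, h, if_pos hX]

theorem suf2Star_eq_suf_one {g : G} {X : Set (List G)} (h : Suf 2 g = ∅) (hX : Suf 1 g = X) :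
    Suf2Star g = X := by
  rw [Suf2Star, h, if_neg Set.not_nonempty_empty, hX]

/-- For every `g ∈ PSL(2,ℤ)` there is `a ∈ {u, u⁻¹}` such that `𝐒₂*(g)` is one of
`∅`, `{r}`, `{ar}`, `{a}`, `{ra}`, `{aa}`, `{ra, aa}`, `{ra, ār}`. -/
theorem suf2Star_cases (g : G) :
    ∃ a ∈ ({u, u⁻¹} : Set G),
      Suf2Star g = (∅ : Set (List G)) ∨
      Suf2Star g = {[r]} ∨
      Suf2Star g = {[a, r]} ∨
      Suf2Star g = {[a]} ∨
      Suf2Star g = {[r, a]} ∨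
      Suf2Star g = {[a, a]} ∨
      Suf2Star g = {[r, a], [a, a]} ∨
      Suf2Star g = {[r, a], [a⁻¹, r]} := by
  obtain ⟨d, l, ⟨rfl, -⟩ | ⟨rfl, -⟩⟩ := exists_low g
  · refine ⟨a d, by cases d <;> simp [a], ?_⟩
    match l with
    | [] =>
      exact Or.inl (suf2Star_eq_suf_one (by simp [suf_two, lastLetters_low_nil])
        (by simp [suf_one, lastLetters_low_nil]))
    | [true] =>
      have h := lastLetters_low_cons d true []
      refine Or.inr <| Or.inr <| Or.inr <| Or.inl <| suf2Star_eq_suf_one ?_ (by simp [suf_one, h])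
      simp [suf_two, h, a_inv, low_mul_a_not_true, lastLetters_low_nil]
    | true :: b :: l =>
      refine Or.inr <| Or.inr <| Or.inr <| Or.inr <| Or.inr <| Or.inl <|
        suf2Star_eq_suf_two ?_ (by simp)
      simp [suf_two, lastLetters_low_cons, a_inv, low_mul_a_not_true]
    | [false] =>
      refine Or.inr <| Or.inr <| Or.inr <| Or.inr <| Or.inl <| suf2Star_eq_suf_two ?_ (by simp)
      simp [suf_two, lastLetters_low_cons, a_inv, low_mul_a_not_false, lastLetters_high_nil]
    | false :: true :: l =>
      refine Or.inr <| Or.inr <| Or.inr <| Or.inr <| Or.inl <| suf2Star_eq_suf_two ?_ (by simp)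
      simp [suf_two, lastLetters_low_cons, a_inv, low_mul_a_not_false, lastLetters_high_true]
    | false :: false :: l =>
      refine Or.inr <| Or.inr <| Or.inr <| Or.inr <| Or.inr <| Or.inr <| Or.inl <|
        suf2Star_eq_suf_two ?_ (by simp)
      simp [suf_two, lastLetters_low_cons, a_inv, low_mul_a_not_false, lastLetters_high_false,
        Set.image_pair]
  · match l with
    | [] =>
      refine ⟨a d, by cases d <;> simp [a], Or.inr <| Or.inl <| suf2Star_eq_suf_one ?_ ?_⟩
      · simp [suf_two, lastLetters_high_nil, lastLetters_low_nil]
      · simp [suf_one, lastLetters_high_nil]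
    | true :: l =>
      refine ⟨a d, by cases d <;> simp [a], Or.inr <| Or.inr <| Or.inl <|
        suf2Star_eq_suf_two ?_ (by simp)⟩
      simp [suf_two, lastLetters_high_true, lastLetters_low_cons]
    | false :: l =>
      refine ⟨a (!d), by cases d <;> simp [a], Or.inr <| Or.inr <| Or.inr <| Or.inr <|
        Or.inr <| Or.inr <| Or.inr <| suf2Star_eq_suf_two ?_ (by simp)⟩
      simp [suf_two, lastLetters_high_false, lastLetters_low_cons, a_inv, high_mul_a_false,
        lastLetters_high_true, Set.pair_comm]

end PSL2Z
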